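/- Let d ≥ 1, let X ⊆ ℝ^{d+1} be open with coordinates (x_0, x_1, …, x_d), let w : X → ℝ be of class C², and let ψ : X → X be of class C². Write H f := ∂_0 f − ∑_{j=1}^d ∂_j² f for the heat operator and ∇_x g := (∂_1 g, …, ∂_d g). Then the following are equivalent. (I) For every smooth u : X → ℂ with H u = 0 on X, the C² function w·(u∘ψ) satisfies H(w·(u∘ψ)) = 0 on X. (II) The following four conditions hold: (a) H w = 0 and H(w ψ_j) = 0 on X for all 1 ≤ j ≤ d; (b) H(w ψ_0) = w·|∇_x ψ_1|² on X; (c) w·|∇_x ψ_0|² = 0 on X and w·|∇_x ψ_j|² = w·|∇_x ψ_k|² on X for all 1 ≤ j,k ≤ d; (d) w·⟨∇_x ψ_j, ∇_x ψ_k⟩ = 0 on X for all 0 ≤ j ≠ k ≤ d. -/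

import Mathlib

open scoped BigOperators

noncomputable section

/-- Partial derivative in the `l`-th coordinate direction of `ℝ^{d+1}`. -/
def pderivE {n : ℕ} {F : Type*} [NormedAddCommGroup F] [NormedSpace ℝ F] (i : Fin n)
    (f : EuclideanSpace ℝ (Fin n) → F) : EuclideanSpace ℝ (Fin n) → F :=
  fun x => fderiv ℝ f x (EuclideanSpace.single i 1)

/-- The heat operator `H f = ∂_0 f − ∑_{j=1}^d ∂_j² f` on `ℝ^{d+1}`
(coordinate `0` is time). -/
def heatOp {d : ℕ} {F : Type*} [NormedAddCommGroup F] [NormedSpace ℝ F]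
    (f : EuclideanSpace ℝ (Fin (d + 1)) → F) : EuclideanSpace ℝ (Fin (d + 1)) → F :=
  fun x => pderivE 0 f x -
    ∑ j ∈ Finset.univ.erase (0 : Fin (d + 1)), pderivE j (pderivE j f) x

theorem fderiv_apply_of_c2 {E F : Type*} [NormedAddCommGroup E] [NormedSpace ℝ E]
    [NormedAddCommGroup F] [NormedSpace ℝ F] {f : E → F} {x : E} (hf : ContDiffAt ℝ 2 f x)
    (v v' : E) :
    fderiv ℝ (fun y => fderiv ℝ f y v) x v' = fderiv ℝ (fderiv ℝ f) x v' v := by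
  have h : DifferentiableAt ℝ (fderiv ℝ f) x :=
    (hf.fderiv_right (m := 1) (by norm_num)).differentiableAt (by norm_num)
  rw [fderiv_clm_apply h (differentiableAt_const v)]
  simp

/-- first derivative of a weighted composition -/
theorem fderiv_wcomp {E G F : Type*} [NormedAddCommGroup E] [NormedSpace ℝ E]
    [NormedAddCommGroup G] [NormedSpace ℝ G]
    [NormedAddCommGroup F] [NormedSpace ℝ F] {w : E → ℝ} {ψ : E → G} {u : G → F} {x : E}
    (hw : DifferentiableAt ℝ w x) (hψ : DifferentiableAt ℝ ψ x)
    (hu : DifferentiableAt ℝ u (ψ x)) (e : E) :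
    fderiv ℝ (fun y => w y • u (ψ y)) x e =
      w x • fderiv ℝ u (ψ x) (fderiv ℝ ψ x e) + fderiv ℝ w x e • u (ψ x) := by
  have h := hw.hasFDerivAt.smul (hu.hasFDerivAt.comp x hψ.hasFDerivAt)
  have h2 : fderiv ℝ (fun y => w y • u (ψ y)) x = _ := h.fderiv
  rw [h2]
  simp

theorem fderiv2_wcomp {E G F : Type*} [NormedAddCommGroup E] [NormedSpace ℝ E]
    [NormedAddCommGroup G] [NormedSpace ℝ G]
    [NormedAddCommGroup F] [NormedSpace ℝ F] {w : E → ℝ} {ψ : E → G} {u : G → F} {x : E}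
    (hw : ContDiffAt ℝ 2 w x) (hψ : ContDiffAt ℝ 2 ψ x)
    (hu : ContDiffAt ℝ 2 u (ψ x)) (e : E) :
    fderiv ℝ (fun z => fderiv ℝ (fun y => w y • u (ψ y)) z e) x e =
      w x • (fderiv ℝ u (ψ x) (fderiv ℝ (fun y => fderiv ℝ ψ y e) x e)
        + fderiv ℝ (fderiv ℝ u) (ψ x) (fderiv ℝ ψ x e) (fderiv ℝ ψ x e))
      + (2 * fderiv ℝ w x e) • fderiv ℝ u (ψ x) (fderiv ℝ ψ x e)
      + (fderiv ℝ (fun y => fderiv ℝ w y e) x e) • u (ψ x) := by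
  have ev : (fun z => fderiv ℝ (fun y => w y • u (ψ y)) z e) =ᶠ[nhds x]
      fun y => w y • fderiv ℝ u (ψ y) (fderiv ℝ ψ y e) + fderiv ℝ w y e • u (ψ y) := by
    have h1 := hw.eventually (by norm_num)
    have h2 := hψ.eventually (by norm_num)
    have h3 := hψ.continuousAt.eventually (hu.eventually (by norm_num))
    filter_upwards [h1, h2, h3] with y a b c
    exact fderiv_wcomp (a.differentiableAt (by norm_num)) (b.differentiableAt (by norm_num))
      (c.differentiableAt (by norm_num)) e
  rw [ev.fderiv_eq]
  have dw := (hw.differentiableAt (by norm_num)).hasFDerivAt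
  have dψ := (hψ.differentiableAt (by norm_num)).hasFDerivAt
  have du := (hu.differentiableAt (by norm_num)).hasFDerivAt
  have dw2 := ((hw.fderiv_right (m := 1) (by norm_num)).differentiableAt
    (by norm_num)).hasFDerivAt.clm_apply (hasFDerivAt_const e x)
  have dψ2 := ((hψ.fderiv_right (m := 1) (by norm_num)).differentiableAt
    (by norm_num)).hasFDerivAt.clm_apply (hasFDerivAt_const e x)
  have du2 := ((hu.fderiv_right (m := 1) (by norm_num)).differentiableAt
    (by norm_num)).hasFDerivAt
  have key := (dw.smul ((du2.comp x dψ).clm_apply dψ2)).add (dw2.smul (du.comp x dψ))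
  have k2 : fderiv ℝ (fun y => w y • fderiv ℝ u (ψ y) (fderiv ℝ ψ y e)
      + fderiv ℝ w y e • u (ψ y)) x = _ := key.fderiv
  rw [k2, fderiv_apply_of_c2 hw, fderiv_apply_of_c2 hψ]
  simp
  module

/-- the drift vector -/
def driftV {d : ℕ} (w : EuclideanSpace ℝ (Fin (d + 1)) → ℝ)
    (ψ : EuclideanSpace ℝ (Fin (d + 1)) → EuclideanSpace ℝ (Fin (d + 1)))
    (x : EuclideanSpace ℝ (Fin (d + 1))) : EuclideanSpace ℝ (Fin (d + 1)) :=
  w x • heatOp ψ x -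
    ∑ i ∈ Finset.univ.erase (0 : Fin (d + 1)), (2 * pderivE i w x) • pderivE i ψ x

theorem heatOp_wcomp {d : ℕ} {F : Type*} [NormedAddCommGroup F] [NormedSpace ℝ F]
    {w : EuclideanSpace ℝ (Fin (d + 1)) → ℝ}
    {ψ : EuclideanSpace ℝ (Fin (d + 1)) → EuclideanSpace ℝ (Fin (d + 1))}
    {u : EuclideanSpace ℝ (Fin (d + 1)) → F}
    {x : EuclideanSpace ℝ (Fin (d + 1))}
    (hw : ContDiffAt ℝ 2 w x) (hψ : ContDiffAt ℝ 2 ψ x)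
    (hu : ContDiffAt ℝ 2 u (ψ x)) :
    heatOp (fun y => w y • u (ψ y)) x =
      heatOp w x • u (ψ x) + fderiv ℝ u (ψ x) (driftV w ψ x)
      - w x • ∑ i ∈ Finset.univ.erase (0 : Fin (d + 1)),
        fderiv ℝ (fderiv ℝ u) (ψ x) (pderivE i ψ x) (pderivE i ψ x) := by
  have h2 := fun i : Fin (d+1) => fderiv2_wcomp hw hψ hu (EuclideanSpace.single i (1:ℝ))
  have h1 := fderiv_wcomp (hw.differentiableAt (by norm_num)) (hψ.differentiableAt (by norm_num))
      (hu.differentiableAt (by norm_num)) (EuclideanSpace.single (0 : Fin (d+1)) (1:ℝ))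
  unfold driftV heatOp
  unfold pderivE
  simp only [h2, h1, map_sub, map_smul, map_sum, Finset.sum_add_distrib, sub_smul,
    Finset.sum_smul, Finset.smul_sum, smul_sub, smul_add]
  abel

theorem c2_pair {E F : Type*} [NormedAddCommGroup E] [NormedSpace ℝ E]
    [NormedAddCommGroup F] [NormedSpace ℝ F] {u : E → F} {a v : E}
    (hu : ContDiff ℝ 2 u) (c : Fin 5 → F)
    (h : ∀ t : ℝ, u (a + t • v) = c 0 + t • c 1 + t ^ 2 • c 2 + t ^ 3 • c 3 + t ^ 4 • c 4) :
    fderiv ℝ u a v = c 1 ∧ fderiv ℝ (fderiv ℝ u) a v v = (2:ℝ) • c 2 := by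
  have line : ∀ t : ℝ, HasDerivAt (fun t : ℝ => a + t • v) v t := fun t => by
    simpa using ((hasDerivAt_id t).smul_const v).const_add a
  have d1 : ∀ t : ℝ, fderiv ℝ u (a + t • v) v =
      c 1 + (2 * t) • c 2 + (3 * t ^ 2) • c 3 + (4 * t ^ 3) • c 4 := by
    intro t
    have A := ((hu.differentiable (by norm_num)) (a + t • v)).hasFDerivAt.comp_hasDerivAt t (line t)
    have B : HasDerivAt (fun t : ℝ => c 0 + t • c 1 + t ^ 2 • c 2 + t ^ 3 • c 3 + t ^ 4 • c 4)
        (c 1 + (2 * t) • c 2 + (3 * t ^ 2) • c 3 + (4 * t ^ 3) • c 4) t := by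
      have := (((((hasDerivAt_id t).smul_const (c 1)).const_add (c 0)).add
        ((hasDerivAt_pow 2 t).smul_const (c 2))).add
        ((hasDerivAt_pow 3 t).smul_const (c 3))).add
        ((hasDerivAt_pow 4 t).smul_const (c 4))
      convert this using 1
      · ext; simp
      · norm_num
    have e : (u ∘ fun t : ℝ => a + t • v) =
      fun t : ℝ => c 0 + t • c 1 + t ^ 2 • c 2 + t ^ 3 • c 3 + t ^ 4 • c 4 := funext h
    rw [e] at A
    exact A.unique B
  refine ⟨by simpa using d1 0, ?_⟩
  have A0 := (((hu.fderiv_right (m := 1) (by norm_num)).differentiable (by norm_num))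
    (a + (0:ℝ) • v)).hasFDerivAt.comp_hasDerivAt (0:ℝ) (line 0)
  have A := A0.clm_apply (hasDerivAt_const (0:ℝ) v)
  have B : HasDerivAt (fun t : ℝ => c 1 + (2 * t) • c 2 + (3 * t ^ 2) • c 3 + (4 * t ^ 3) • c 4)
        ((2:ℝ) • c 2) 0 := by
    have := (((((hasDerivAt_id (0:ℝ)).const_mul 2).smul_const (c 2)).const_add (c 1)).add
        (((hasDerivAt_pow 2 (0:ℝ)).const_mul 3).smul_const (c 3))).add
        (((hasDerivAt_pow 3 (0:ℝ)).const_mul 4).smul_const (c 4))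
    convert this using 1
    · ext; simp
    · norm_num
  have e : (fun y : ℝ => ((fderiv ℝ u ∘ fun t : ℝ => a + t • v) y) v) = _ := funext d1
  rw [e] at A
  simpa using A.unique B

theorem pderivE_coord {d : ℕ}
    {ψ : EuclideanSpace ℝ (Fin (d + 1)) → EuclideanSpace ℝ (Fin (d + 1))}
    {x : EuclideanSpace ℝ (Fin (d + 1))} (hψ : DifferentiableAt ℝ ψ x) (i l : Fin (d + 1)) :
    pderivE i (fun y => ψ y l) x = pderivE i ψ x l := by
  have h := ((EuclideanSpace.proj (𝕜 := ℝ) l).hasFDerivAt (x := ψ x)).comp x hψ.hasFDerivAt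
  have h2 : fderiv ℝ (fun y => ψ y l) x = _ := h.fderiv
  unfold pderivE
  rw [h2]
  simp

theorem heatOp_w_coord {d : ℕ}
    {w : EuclideanSpace ℝ (Fin (d + 1)) → ℝ}
    {ψ : EuclideanSpace ℝ (Fin (d + 1)) → EuclideanSpace ℝ (Fin (d + 1))}
    {x : EuclideanSpace ℝ (Fin (d + 1))}
    (hw : ContDiffAt ℝ 2 w x) (hψ : ContDiffAt ℝ 2 ψ x) (l : Fin (d + 1)) :
    heatOp (fun y => w y * ψ y l) x = heatOp w x * ψ x l + driftV w ψ x l := by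
  have h := heatOp_wcomp (u := fun z => EuclideanSpace.proj (𝕜 := ℝ) l z) hw hψ
    (EuclideanSpace.proj (𝕜 := ℝ) l).contDiff.contDiffAt
  have e : fderiv ℝ (fun z : EuclideanSpace ℝ (Fin (d + 1)) => EuclideanSpace.proj (𝕜 := ℝ) l z)
      = fun _ => EuclideanSpace.proj (𝕜 := ℝ) l := by
    funext z
    exact (EuclideanSpace.proj (𝕜 := ℝ) l).fderiv
  rw [e] at h
  simpa using h

theorem heat_test {d : ℕ}
    {X : Set (EuclideanSpace ℝ (Fin (d + 1)))}
    {w : EuclideanSpace ℝ (Fin (d + 1)) → ℝ}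
    {ψ : EuclideanSpace ℝ (Fin (d + 1)) → EuclideanSpace ℝ (Fin (d + 1))}
    (hI : ∀ u : EuclideanSpace ℝ (Fin (d + 1)) → ℂ, ContDiffOn ℝ (⊤ : ℕ∞) u X →
      (∀ x ∈ X, heatOp u x = 0) →
      ∀ x ∈ X, heatOp (fun y => (w y : ℂ) * u (ψ y)) x = 0)
    {x : EuclideanSpace ℝ (Fin (d + 1))} (hx : x ∈ X)
    (hw : ContDiffAt ℝ 2 w x) (hψ : ContDiffAt ℝ 2 ψ x)
    (p : EuclideanSpace ℝ (Fin (d + 1)) → ℝ) (hp : ContDiff ℝ (⊤ : ℕ∞) p)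
    (c : EuclideanSpace ℝ (Fin (d + 1)) → EuclideanSpace ℝ (Fin (d + 1)) → Fin 5 → ℝ)
    (hc : ∀ a v, ∀ t : ℝ, p (a + t • v) =
      c a v 0 + t * c a v 1 + t ^ 2 * c a v 2 + t ^ 3 * c a v 3 + t ^ 4 * c a v 4)
    (hH : ∀ a, c a (EuclideanSpace.single 0 1) 1 =
      ∑ j ∈ Finset.univ.erase (0 : Fin (d + 1)), 2 * c a (EuclideanSpace.single j 1) 2) :
    heatOp w x * p (ψ x) + c (ψ x) (driftV w ψ x) 1
      - w x * ∑ i ∈ Finset.univ.erase (0 : Fin (d + 1)), 2 * c (ψ x) (pderivE i ψ x) 2 = 0 := by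
  have hu : ContDiff ℝ (⊤ : ℕ∞) (fun y => (p y : ℂ)) := Complex.ofRealCLM.contDiff.comp hp
  have hu2 : ContDiff ℝ 2 (fun y => (p y : ℂ)) := hu.of_le (WithTop.coe_le_coe.2 (le_top : (2 : ℕ∞) ≤ ⊤))
  have key := fun a v => c2_pair (a := a) (v := v) hu2 (fun i => ((c a v i : ℝ) : ℂ))
    (fun t => by rw [hc]; simp)
  have H0 : ∀ y ∈ X, heatOp (fun y => (p y : ℂ)) y = 0 := by
    intro y _
    unfold heatOp pderivE
    rw [(key _ _).1, hH]
    simp only [fderiv_apply_of_c2 hu2.contDiffAt, (key _ _).2]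
    simp
  have h := hI _ hu.contDiffOn H0 x hx
  have h' := heatOp_wcomp (u := fun y => (p y : ℂ)) hw hψ hu2.contDiffAt
  simp only [Complex.real_smul, (key _ _).1, (key _ _).2] at h'
  rw [h] at h'
  exact_mod_cast h'.symm

theorem vec_expand {n : ℕ} (v : EuclideanSpace ℝ (Fin n)) :
    v = ∑ l, v l • EuclideanSpace.single l (1 : ℝ) := by
  ext m
  simp [Finset.sum_apply, Pi.single_apply]

theorem quad_expand {d : ℕ} {F : Type*} [NormedAddCommGroup F] [NormedSpace ℝ F]
    (B : EuclideanSpace ℝ (Fin (d + 1)) →L[ℝ] EuclideanSpace ℝ (Fin (d + 1)) →L[ℝ] F)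
    (v : Fin (d + 1) → EuclideanSpace ℝ (Fin (d + 1))) (s : ℝ) (K : ℝ)
    (h0 : s * ∑ i ∈ Finset.univ.erase (0 : Fin (d + 1)), v i 0 ^ 2 = 0)
    (h1 : ∀ j, j ≠ 0 → s * ∑ i ∈ Finset.univ.erase (0 : Fin (d + 1)), v i j ^ 2 = K)
    (h2 : ∀ j k, j ≠ k → s * ∑ i ∈ Finset.univ.erase (0 : Fin (d + 1)), v i j * v i k = 0) :
    s • ∑ i ∈ Finset.univ.erase (0 : Fin (d + 1)), B (v i) (v i) =
      K • ∑ j ∈ Finset.univ.erase (0 : Fin (d + 1)),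
        B (EuclideanSpace.single j 1) (EuclideanSpace.single j 1) := by
  have e : ∀ i, B (v i) (v i) = ∑ l, ∑ m, (v i l * v i m) •
      B (EuclideanSpace.single l 1) (EuclideanSpace.single m 1) := by
    intro i
    conv_lhs => rw [vec_expand (v i)]
    simp only [map_sum, map_smul, sum_apply, smul_apply,
      Finset.smul_sum, smul_smul]
    rw [Finset.sum_comm]
    refine Finset.sum_congr rfl fun l _ => Finset.sum_congr rfl fun m _ => ?_
    rw [mul_comm]
  have e2 : s • ∑ i ∈ Finset.univ.erase (0 : Fin (d + 1)), B (v i) (v i) =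
      ∑ l, ∑ m, (s * ∑ i ∈ Finset.univ.erase (0 : Fin (d + 1)), v i l * v i m) •
      B (EuclideanSpace.single l 1) (EuclideanSpace.single m 1) := by
    simp only [e]
    rw [Finset.sum_comm, Finset.smul_sum]
    refine Finset.sum_congr rfl fun l _ => ?_
    rw [Finset.sum_comm, Finset.smul_sum]
    refine Finset.sum_congr rfl fun m _ => ?_
    rw [← Finset.sum_smul, smul_smul]
  rw [e2]
  have e3 : ∀ l, ∑ m, (s * ∑ i ∈ Finset.univ.erase (0 : Fin (d + 1)), v i l * v i m) •
      B (EuclideanSpace.single l 1) (EuclideanSpace.single m 1) =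
      (s * ∑ i ∈ Finset.univ.erase (0 : Fin (d + 1)), v i l ^ 2) •
      B (EuclideanSpace.single l 1) (EuclideanSpace.single l 1) := by
    intro l
    rw [Finset.sum_eq_single l]
    · simp only [pow_two]
    · intro m _ hm
      rw [h2 l m hm.symm, zero_smul]
    · simp
  simp only [e3]
  rw [← Finset.add_sum_erase _ _ (Finset.mem_univ (0 : Fin (d + 1))), h0, zero_smul, zero_add,
    Finset.smul_sum]
  refine Finset.sum_congr rfl fun j hj => ?_
  rw [h1 j (Finset.ne_of_mem_erase hj)]

/-- Characterization, in terms of the weight `w` and the symbol `ψ`, of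
when the weighted composition operator `C_{w,ψ}` maps the kernel of the heat operator in
`C^∞(X)` into solutions of the heat equation. -/
theorem heat_kernel_invariance_characterization
    {d : ℕ} (hd : 1 ≤ d)
    (X : Set (EuclideanSpace ℝ (Fin (d + 1)))) (hX : IsOpen X)
    (w : EuclideanSpace ℝ (Fin (d + 1)) → ℝ) (hw : ContDiffOn ℝ 2 w X)
    (ψ : EuclideanSpace ℝ (Fin (d + 1)) → EuclideanSpace ℝ (Fin (d + 1)))
    (hψ : ContDiffOn ℝ 2 ψ X) (hψX : Set.MapsTo ψ X X) :
    -- (I): C_{w,ψ} maps smooth solutions of the heat equation to solutions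
    (∀ u : EuclideanSpace ℝ (Fin (d + 1)) → ℂ, ContDiffOn ℝ (⊤ : ℕ∞) u X →
      (∀ x ∈ X, heatOp u x = 0) →
      ∀ x ∈ X, heatOp (fun y => (w y : ℂ) * u (ψ y)) x = 0) ↔
    -- (II)(a)
    (((∀ x ∈ X, heatOp w x = 0) ∧
      (∀ j : Fin (d + 1), j ≠ 0 → ∀ x ∈ X, heatOp (fun y => w y * ψ y j) x = 0)) ∧
    -- (II)(b)
     (∀ x ∈ X, heatOp (fun y => w y * ψ y 0) x =
        w x * ∑ i ∈ Finset.univ.erase (0 : Fin (d + 1)),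
          (pderivE i (fun y => ψ y 1) x) ^ 2) ∧
    -- (II)(c)
     ((∀ x ∈ X, w x * ∑ i ∈ Finset.univ.erase (0 : Fin (d + 1)),
          (pderivE i (fun y => ψ y 0) x) ^ 2 = 0) ∧
      (∀ j k : Fin (d + 1), j ≠ 0 → k ≠ 0 → ∀ x ∈ X,
        w x * ∑ i ∈ Finset.univ.erase (0 : Fin (d + 1)),
            (pderivE i (fun y => ψ y j) x) ^ 2 =
          w x * ∑ i ∈ Finset.univ.erase (0 : Fin (d + 1)),
            (pderivE i (fun y => ψ y k) x) ^ 2)) ∧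
    -- (II)(d)
     (∀ j k : Fin (d + 1), j ≠ k → ∀ x ∈ X,
        w x * ∑ i ∈ Finset.univ.erase (0 : Fin (d + 1)),
          pderivE i (fun y => ψ y j) x * pderivE i (fun y => ψ y k) x = 0)) := by
  have cw : ∀ x ∈ X, ContDiffAt ℝ 2 w x := fun x hx => hw.contDiffAt (hX.mem_nhds hx)
  have cψ : ∀ x ∈ X, ContDiffAt ℝ 2 ψ x := fun x hx => hψ.contDiffAt (hX.mem_nhds hx)
  have pc : ∀ x ∈ X, ∀ i l, pderivE i (fun y => ψ y l) x = pderivE i ψ x l := fun x hx i l =>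
    pderivE_coord ((cψ x hx).differentiableAt (by norm_num)) i l
  have h10 : (1 : Fin (d + 1)) ≠ 0 := by
    intro h
    have := congrArg Fin.val h
    rw [Fin.val_one', Fin.val_zero, Nat.mod_eq_of_lt (by omega)] at this
    omega
  constructor
  · intro hI
    have T := fun x hx => heat_test hI hx (cw x hx) (cψ x hx)
    have hW : ∀ x ∈ X, heatOp w x = 0 := by
      intro x hx
      have := T x hx (fun _ => 1) contDiff_const (fun _ _ => ![1, 0, 0, 0, 0])
        (by intros; simp) (by intros; simp)
      simpa using this
    have hV : ∀ j : Fin (d + 1), j ≠ 0 → ∀ x ∈ X, driftV w ψ x j = 0 := by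
      intro j hj x hx
      have := T x hx (fun y => y j) (by fun_prop) (fun a v => ![a j, v j, 0, 0, 0])
        (by intros; simp) (by intros; simp [hj])
      simpa [hW x hx] using this
    have hV0 : ∀ j : Fin (d + 1), j ≠ 0 → ∀ x ∈ X, driftV w ψ x 0 =
        w x * ∑ i ∈ Finset.univ.erase (0 : Fin (d + 1)), pderivE i ψ x j ^ 2 := by
      intro j hj x hx
      have := T x hx (fun y => y 0 + (y j - ψ x j) ^ 2 / 2) (by fun_prop)
        (fun a v => ![a 0 + (a j - ψ x j) ^ 2 / 2, v 0 + (a j - ψ x j) * v j, v j ^ 2 / 2, 0, 0])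
        (by intros; simp; ring)
        (by
          intro a
          rw [Finset.sum_eq_single_of_mem j (by simp [hj])]
          · simp [hj]
          · intro b _ hb
            simp [hb.symm])
      simp [hW x hx, mul_div_cancel₀] at this
      simp only [Finset.mem_univ, Finset.sum_erase_eq_sub]
      linarith
    have hD : ∀ j k : Fin (d + 1), j ≠ 0 → k ≠ 0 → j ≠ k → ∀ x ∈ X,
        w x * ∑ i ∈ Finset.univ.erase (0 : Fin (d + 1)), pderivE i ψ x j * pderivE i ψ x k = 0 := by
      intro j k hj hk hjk x hx
      have := T x hx (fun y => (y j - ψ x j) * (y k - ψ x k)) (by fun_prop)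
        (fun a v => ![(a j - ψ x j) * (a k - ψ x k),
          (a j - ψ x j) * v k + v j * (a k - ψ x k), v j * v k, 0, 0])
        (by intros; simp; ring)
        (by
          intro a
          rw [Finset.sum_eq_zero]
          · simp [hj, hk]
          · intro b _
            by_cases h : j = b
            · subst h; simp [hjk.symm]
            · simp [h])
      simp [← Finset.mul_sum] at this
      simpa using this
    have hD0 : ∀ j : Fin (d + 1), j ≠ 0 → ∀ x ∈ X,
        w x * ∑ i ∈ Finset.univ.erase (0 : Fin (d + 1)), pderivE i ψ x 0 * pderivE i ψ x j = 0 := by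
      intro j hj x hx
      have := T x hx (fun y => (y 0 - ψ x 0) * (y j - ψ x j) + (y j - ψ x j) ^ 3 / 6) (by fun_prop)
        (fun a v => ![(a 0 - ψ x 0) * (a j - ψ x j) + (a j - ψ x j) ^ 3 / 6,
          (a 0 - ψ x 0) * v j + v 0 * (a j - ψ x j) + (a j - ψ x j) ^ 2 * v j / 2,
          v 0 * v j + (a j - ψ x j) * v j ^ 2 / 2, v j ^ 3 / 6, 0])
        (by intros; simp; ring)
        (by
          intro a
          rw [Finset.sum_eq_single_of_mem j (by simp [hj])]
          · simp [hj, hj.symm]; ring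
          · intro b hb' hb
            simp [hb.symm])
      simp [← Finset.mul_sum] at this
      simpa using this
    have hC0 : ∀ x ∈ X,
        w x * ∑ i ∈ Finset.univ.erase (0 : Fin (d + 1)), pderivE i ψ x 0 ^ 2 = 0 := by
      intro x hx
      have := T x hx (fun y => (y 0 - ψ x 0) ^ 2 / 2 + (y 0 - ψ x 0) * (y 1 - ψ x 1) ^ 2 / 2
          + (y 1 - ψ x 1) ^ 4 / 24) (by fun_prop)
        (fun a v => ![(a 0 - ψ x 0) ^ 2 / 2 + (a 0 - ψ x 0) * (a 1 - ψ x 1) ^ 2 / 2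
            + (a 1 - ψ x 1) ^ 4 / 24,
          (a 0 - ψ x 0) * v 0 + v 0 * (a 1 - ψ x 1) ^ 2 / 2
            + (a 0 - ψ x 0) * (a 1 - ψ x 1) * v 1 + (a 1 - ψ x 1) ^ 3 * v 1 / 6,
          v 0 ^ 2 / 2 + v 0 * (a 1 - ψ x 1) * v 1 + (a 0 - ψ x 0) * v 1 ^ 2 / 2
            + (a 1 - ψ x 1) ^ 2 * v 1 ^ 2 / 4,
          v 0 * v 1 ^ 2 / 2 + (a 1 - ψ x 1) * v 1 ^ 3 / 6, v 1 ^ 4 / 24])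
        (by intros; simp; ring)
        (by
          intro a
          rw [Finset.sum_eq_single_of_mem 1 (by simp [h10])]
          · simp [h10, h10.symm]; ring
          · intro b hb' hb
            have hb0 := Finset.ne_of_mem_erase hb'
            simp [hb.symm, hb0.symm])
      simp [mul_div_cancel₀] at this
      simpa using this
    refine ⟨⟨hW, ?_⟩, ?_, ⟨?_, ?_⟩, ?_⟩
    · intro j hj x hx
      rw [heatOp_w_coord (cw x hx) (cψ x hx), hW x hx, hV j hj x hx]; simp
    · intro x hx
      rw [heatOp_w_coord (cw x hx) (cψ x hx), hW x hx, hV0 1 h10 x hx]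
      simp only [pc x hx]; simp
    · intro x hx
      simp only [pc x hx]; exact hC0 x hx
    · intro j k hj hk x hx
      simp only [pc x hx]; rw [← hV0 j hj x hx, ← hV0 k hk x hx]
    · intro j k hjk x hx
      simp only [pc x hx]
      by_cases hj : j = 0
      · subst hj; exact hD0 k hjk.symm x hx
      · by_cases hk : k = 0
        · subst hk
          simp only [mul_comm (pderivE _ ψ x j)]
          exact hD0 j hj x hx
        · exact hD j k hj hk hjk x hx
  · rintro ⟨⟨hW, hWj⟩, hb, ⟨hc0, hc⟩, hd'⟩ u hu hHu x hx
    have cu : ContDiffAt ℝ 2 u (ψ x) :=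
      (hu.contDiffAt (hX.mem_nhds (hψX hx))).of_le (WithTop.coe_le_coe.2 (le_top : (2 : ℕ∞) ≤ ⊤))
    have F := heatOp_wcomp (cw x hx) (cψ x hx) cu
    set K := w x * ∑ i ∈ Finset.univ.erase (0 : Fin (d + 1)), pderivE i ψ x 1 ^ 2 with hK
    have bx := hb x hx
    have c0x := hc0 x hx
    have cx := fun j k hj hk => hc j k hj hk x hx
    have dx := fun j k hjk => hd' j k hjk x hx
    simp only [pc x hx] at bx c0x cx dx
    rw [quad_expand _ (fun i => pderivE i ψ x) (w x) K c0x (fun j hj => cx j 1 hj h10) dx] at F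
    have V : driftV w ψ x = K • EuclideanSpace.single 0 1 := by
      ext l
      have hl := heatOp_w_coord (cw x hx) (cψ x hx) l
      rw [hW x hx] at hl
      by_cases h : l = 0
      · subst h
        rw [bx, ← hK] at hl
        simpa using hl.symm
      · rw [hWj l h x hx] at hl
        simpa [h] using hl.symm
    rw [V, hW x hx] at F
    simp only [Complex.real_smul] at F
    rw [F]
    have G := hHu (ψ x) (hψX hx)
    unfold heatOp pderivE at G
    simp only [fderiv_apply_of_c2 cu] at G
    rw [map_smul, Complex.real_smul, Complex.ofReal_zero, zero_mul, zero_add, ← mul_sub, G,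
      mul_zero]

end
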